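/- arXiv:2211.04538 — 6 statements merged into one kernel-verified Lean document; each statement's English description precedes it below -/
import Mathlib

section
/- Let Π be a nonempty set of policies, 𝓜_α a nonempty set of models, J : 𝓜_α → Π → ℝ, and let M⋆ ∈ 𝓜_α (the true model) and π_ref ∈ Π (the reference policy). Assume that for each π ∈ Π the set {J_M(π) − J_M(π_ref) : M ∈ 𝓜_α} is bounded below, and that π̂ ∈ Π maximizes the relative-pessimism objective, i.e. inf_{M∈𝓜_α}(J_M(π̂) − J_M(π_ref)) ≥ inf_{M∈𝓜_α}(J_M(π) − J_M(π_ref)) for every π ∈ Π. Then J_{M⋆}(π̂) ≥ J_{M⋆}(π_ref). -/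
/-- ARMOR robust strong policy improvement (deterministic core of Theorem 3.2):
if the true model `Mstar` lies in the version space `Ma` and `pihat` maximizes the
relative-pessimism objective `π ↦ inf_{M ∈ Ma} (J M π - J M piref)` over `Pi`,
then `pihat` does not degrade the value of the reference policy in the true model. -/
theorem armor_robust_policy_improvement {Policy Model : Type*}
    (Pi : Set Policy) (Ma : Set Model)
    (hPi : Pi.Nonempty) (hMa : Ma.Nonempty)
    (J : Model → Policy → ℝ)
    (Mstar : Model) (hMstar : Mstar ∈ Ma)
    (piref : Policy) (href : piref ∈ Pi)
    (pihat : Policy) (hhat : pihat ∈ Pi)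
    (hbdd : ∀ π ∈ Pi, BddBelow ((fun M => J M π - J M piref) '' Ma))
    (hopt : ∀ π ∈ Pi, sInf ((fun M => J M π - J M piref) '' Ma) ≤
      sInf ((fun M => J M pihat - J M piref) '' Ma)) :
    J Mstar piref ≤ J Mstar pihat := by
  have h1 := csInf_le (hbdd pihat hhat) (Set.mem_image_of_mem _ hMstar)
  have h0 : (0 : ℝ) ≤ sInf ((fun M => J M piref - J M piref) '' Ma) := by
    apply le_csInf (hMa.image _)
    rintro _ ⟨M, _, rfl⟩
    simp
  have h2 := hopt piref href
  have h3 : (0 : ℝ) ≤ J Mstar pihat - J Mstar piref := h0.trans (h2.trans h1)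
  linarith
end

section
/- Let Π be a nonempty set of policies, 𝓜_α a nonempty set of models, J : 𝓜_α → Π → ℝ, M⋆ ∈ 𝓜_α, π_ref ∈ Π, and π† ∈ Π. Assume that for each π ∈ Π the set {J_M(π) − J_M(π_ref) : M ∈ 𝓜_α} is bounded below, that π̂ ∈ Π maximizes π ↦ inf_{M∈𝓜_α}(J_M(π) − J_M(π_ref)) over Π, and that the sets {|J_{M⋆}(π†) − J_M(π†)| : M ∈ 𝓜_α} and {|J_{M⋆}(π_ref) − J_M(π_ref)| : M ∈ 𝓜_α} are bounded above. Then J_{M⋆}(π†) − J_{M⋆}(π̂) ≤ sup_{M∈𝓜_α}|J_{M⋆}(π†) − J_M(π†)| + sup_{M∈𝓜_α}|J_{M⋆}(π_ref) − J_M(π_ref)|. -/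
/-- Conclusion of Theorem 3.1 (absolute performance) in abstract form: the suboptimality
of the ARMOR output `pihat` against a comparator `picom` is bounded by the sum of the
worst-case model-evaluation errors of `picom` and of the reference policy `piref`. -/
theorem armor_absolute_performance_error_bound {Policy Model : Type*}
    (Pi : Set Policy) (Ma : Set Model)
    (hPi : Pi.Nonempty) (hMa : Ma.Nonempty)
    (J : Model → Policy → ℝ)
    (Mstar : Model) (hMstar : Mstar ∈ Ma)
    (piref : Policy) (href : piref ∈ Pi)
    (picom : Policy) (hcom : picom ∈ Pi)
    (pihat : Policy) (hhat : pihat ∈ Pi)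
    (hbdd : ∀ π ∈ Pi, BddBelow ((fun M => J M π - J M piref) '' Ma))
    (hopt : ∀ π ∈ Pi, sInf ((fun M => J M π - J M piref) '' Ma) ≤
      sInf ((fun M => J M pihat - J M piref) '' Ma))
    (hbddcom : BddAbove ((fun M => |J Mstar picom - J M picom|) '' Ma))
    (hbddref : BddAbove ((fun M => |J Mstar piref - J M piref|) '' Ma)) :
    J Mstar picom - J Mstar pihat ≤
      sSup ((fun M => |J Mstar picom - J M picom|) '' Ma) +
        sSup ((fun M => |J Mstar piref - J M piref|) '' Ma) := by
  have h1 : sInf ((fun M => J M pihat - J M piref) '' Ma) ≤ J Mstar pihat - J Mstar piref :=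
    csInf_le (hbdd pihat hhat) ⟨Mstar, hMstar, rfl⟩
  have h2 : J Mstar picom - J Mstar piref
      - sSup ((fun M => |J Mstar picom - J M picom|) '' Ma)
      - sSup ((fun M => |J Mstar piref - J M piref|) '' Ma)
      ≤ sInf ((fun M => J M picom - J M piref) '' Ma) := by
    apply le_csInf (hMa.image _)
    rintro _ ⟨M, hM, rfl⟩
    have a : |J Mstar picom - J M picom| ≤ _ := le_csSup hbddcom ⟨M, hM, rfl⟩
    have b : |J Mstar piref - J M piref| ≤ _ := le_csSup hbddref ⟨M, hM, rfl⟩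
    have a' := le_abs_self (J Mstar picom - J M picom)
    have b' := neg_abs_le (J Mstar piref - J M piref)
    show _ ≤ J M picom - J M piref
    linarith
  have h3 := hopt picom hcom
  linarith
end

section
/- Let Π be a nonempty set of policies, 𝓜_α a nonempty set of models, and J : 𝓜_α → Π → ℝ. Let 𝓜 ⊆ 𝓜_α be nonempty and ψ : 𝓜 → ℝ, and assume for each π' ∈ Π the set {J_M(π') + ψ(M) : M ∈ 𝓜} is bounded below. Suppose π ∈ Π satisfies inf_{M∈𝓜}(J_M(π) + ψ(M)) ≥ inf_{M∈𝓜}(J_M(π') + ψ(M)) for every π' ∈ Π. Then π is a fixed point of the relative-pessimism operator: for every π' ∈ Π, inf_{M∈𝓜_α}(J_M(π') − J_M(π)) ≤ 0. -/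
/-- Forward direction of the Fixed-point Lemma (Lemma 4.4): if `π` maximizes
`π' ↦ inf_{M ∈ Msub} (J M π' + ψ M)` over `Pi` for some nonempty `Msub ⊆ Ma` and some
`ψ : Model → ℝ`, then `π` is a fixed point of the relative-pessimism operator, i.e.
`inf_{M ∈ Ma} (J M π' - J M π) ≤ 0` for every `π' ∈ Pi`. -/
theorem fixed_point_lemma_forward {Policy Model : Type*}
    (Pi : Set Policy) (Ma : Set Model)
    (hPi : Pi.Nonempty) (hMa : Ma.Nonempty)
    (J : Model → Policy → ℝ)
    (Msub : Set Model) (hsub : Msub ⊆ Ma) (hMsub : Msub.Nonempty)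
    (ψ : Model → ℝ)
    (hbdd : ∀ π' ∈ Pi, BddBelow ((fun M => J M π' + ψ M) '' Msub))
    (π : Policy) (hπ : π ∈ Pi)
    (hopt : ∀ π' ∈ Pi, sInf ((fun M => J M π' + ψ M) '' Msub) ≤
      sInf ((fun M => J M π + ψ M) '' Msub)) :
    ∀ π' ∈ Pi, sInf ((fun M => J M π' - J M π) '' Ma) ≤ 0 := by
  intro π' hπ'
  by_contra! hc
  have hb : BddBelow ((fun M => J M π' - J M π) '' Ma) := by
    by_contra h
    rw [Real.sInf_of_not_bddBelow h] at hc
    exact lt_irrefl _ hc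
  have key : sInf ((fun M => J M π + ψ M) '' Msub) + sInf ((fun M => J M π' - J M π) '' Ma)
      ≤ sInf ((fun M => J M π' + ψ M) '' Msub) := by
    apply le_csInf (hMsub.image _)
    rintro _ ⟨M, hM, rfl⟩
    have h1 : sInf ((fun M => J M π + ψ M) '' Msub) ≤ J M π + ψ M :=
      csInf_le (hbdd π hπ) ⟨M, hM, rfl⟩
    have h2 : sInf ((fun M => J M π' - J M π) '' Ma) ≤ J M π' - J M π :=
      csInf_le hb ⟨M, hsub hM, rfl⟩
    show _ ≤ J M π' + ψ M
    linarith
  linarith [hopt π' hπ']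
end

section
/- Let Π be a nonempty set of policies, 𝓜_α a nonempty set of models, and J : 𝓜_α → Π → ℝ. Let π_ref ∈ Π be any reference policy, and assume for each π' ∈ Π the set {J_M(π') − J_M(π_ref) : M ∈ 𝓜_α} is bounded below. If π ∈ Π is a relative-pessimism policy with respect to π_ref, i.e. π maximizes π' ↦ inf_{M∈𝓜_α}(J_M(π') − J_M(π_ref)) over Π, then π is a fixed point of the relative-pessimism operator: for every π' ∈ Π, inf_{M∈𝓜_α}(J_M(π') − J_M(π)) ≤ 0. -/
/-- Item 2 of Corollary 4.5: any relative-pessimism policy with respect to an arbitrary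
reference policy `piref ∈ Pi`, i.e. a maximizer of
`π' ↦ inf_{M ∈ Ma} (J M π' - J M piref)` over `Pi`, is a fixed point of the
relative-pessimism operator. -/
theorem relative_pessimism_is_fixed_point {Policy Model : Type*}
    (Pi : Set Policy) (Ma : Set Model)
    (hPi : Pi.Nonempty) (hMa : Ma.Nonempty)
    (J : Model → Policy → ℝ)
    (piref : Policy) (href : piref ∈ Pi)
    (hbdd : ∀ π' ∈ Pi, BddBelow ((fun M => J M π' - J M piref) '' Ma))
    (π : Policy) (hπ : π ∈ Pi)
    (hopt : ∀ π' ∈ Pi, sInf ((fun M => J M π' - J M piref) '' Ma) ≤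
      sInf ((fun M => J M π - J M piref) '' Ma)) :
    ∀ π' ∈ Pi, sInf ((fun M => J M π' - J M π) '' Ma) ≤ 0 := by
  intro π' hπ'
  by_contra hc
  have hc : 0 < sInf ((fun M => J M π' - J M π) '' Ma) := not_le.mp hc
  have hb : BddBelow ((fun M => J M π' - J M π) '' Ma) := by
    by_contra hn
    rw [Real.sInf_of_not_bddBelow hn] at hc
    exact lt_irrefl _ hc
  have key : sInf ((fun M => J M π' - J M π) '' Ma) +
      sInf ((fun M => J M π - J M piref) '' Ma) ≤
      sInf ((fun M => J M π' - J M piref) '' Ma) := by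
    apply le_csInf (hMa.image _)
    rintro _ ⟨M, hM, rfl⟩
    have h1 : _ ≤ J M π' - J M π := csInf_le hb ⟨M, hM, rfl⟩
    have h2 : _ ≤ J M π - J M piref := csInf_le (hbdd π hπ) ⟨M, hM, rfl⟩
    show _ ≤ J M π' - J M piref
    linarith
  have := hopt π' hπ'
  linarith
end

section
/- Let Π be a nonempty set of policies, 𝓜_α a nonempty set of models, and J : 𝓜_α → Π → ℝ. Assume for each M ∈ 𝓜_α the set {J_M(π'') : π'' ∈ Π} is bounded above, and for each π' ∈ Π the set {J_M(π') − sup_{π''∈Π} J_M(π'') : M ∈ 𝓜_α} is bounded below. If π ∈ Π is a regret-minimization policy, i.e. π maximizes π' ↦ inf_{M∈𝓜_α}(J_M(π') − sup_{π''∈Π} J_M(π'')) over Π, then π is a fixed point of the relative-pessimism operator: for every π' ∈ Π, inf_{M∈𝓜_α}(J_M(π') − J_M(π)) ≤ 0. -/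
/-- Item 3 of Corollary 4.5: any regret-minimization policy, i.e. a maximizer of
`π' ↦ inf_{M ∈ Ma} (J M π' - sup_{π'' ∈ Pi} J M π'')` over `Pi`, is a fixed point of the
relative-pessimism operator. -/
theorem regret_minimization_is_fixed_point {Policy Model : Type*}
    (Pi : Set Policy) (Ma : Set Model)
    (hPi : Pi.Nonempty) (hMa : Ma.Nonempty)
    (J : Model → Policy → ℝ)
    (hbddAbove : ∀ M ∈ Ma, BddAbove ((fun π'' => J M π'') '' Pi))
    (hbdd : ∀ π' ∈ Pi,
      BddBelow ((fun M => J M π' - sSup ((fun π'' => J M π'') '' Pi)) '' Ma))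
    (π : Policy) (hπ : π ∈ Pi)
    (hopt : ∀ π' ∈ Pi,
      sInf ((fun M => J M π' - sSup ((fun π'' => J M π'') '' Pi)) '' Ma) ≤
        sInf ((fun M => J M π - sSup ((fun π'' => J M π'') '' Pi)) '' Ma)) :
    ∀ π' ∈ Pi, sInf ((fun M => J M π' - J M π) '' Ma) ≤ 0 := by
  intro π' hπ'
  by_contra hc
  have hc := not_le.mp hc
  have hB : BddBelow ((fun M => J M π' - J M π) '' Ma) := by
    by_contra h
    rw [Real.sInf_of_not_bddBelow h] at hc
    exact lt_irrefl _ hc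
  have h1 : sInf ((fun M => J M π' - J M π) '' Ma) +
      sInf ((fun M => J M π - sSup ((fun π'' => J M π'') '' Pi)) '' Ma) ≤
      sInf ((fun M => J M π' - sSup ((fun π'' => J M π'') '' Pi)) '' Ma) := by
    apply le_csInf (hMa.image _)
    rintro _ ⟨M, hM, rfl⟩
    have a := csInf_le hB (Set.mem_image_of_mem _ hM)
    have b := csInf_le (hbdd π hπ) (Set.mem_image_of_mem _ hM)
    simp only at a b ⊢
    linarith
  have h2 := hopt π' hπ'
  linarith
end

section
/- Let S and A be nonempty finite types, let μ be a probability mass function on S × A, let 𝓜 be a finite nonempty set of candidate transition models, where each M ∈ 𝓜 assigns to each (s, a) ∈ S × A a probability mass function P_M(· | s, a) on S with P_M(s' | s, a) > 0 for all s, a, s', and let M⋆ ∈ 𝓜 be the true model with kernel P⋆ = P_{M⋆}. Let the dataset D = ((s_i, a_i, s'_i))_{i=1}^n consist of n i.i.d. draws from the law ν on S × A × S given by (s, a) ∼ μ, s' ∼ P⋆(· | s, a). Then for any δ ∈ (0, 1], with probability at least 1 − δ over D ∼ ν^⊗n: for every M ∈ 𝓜, ∑_{i=1}^n log P_M(s'_i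 | s_i, a_i) − ∑_{i=1}^n log P⋆(s'_i | s_i, a_i) ≤ log(|𝓜|/δ). -/
open Finset

/-- Lemma A.3 (finite state-action, transition-only form): for a finite model class `𝓜`
of everywhere-positive transition models containing the true model `Mstar`, and a dataset
of `n` i.i.d. transitions drawn with `(s, a) ∼ μ` and `s' ∼ P Mstar (·|s, a)`, with
probability at least `1 - δ` every model's log-likelihood exceeds that of the true model
by at most `log (|𝓜| / δ)`. The probability of the bad event under the `n`-fold product
measure is written as a sum of the product weights over the bad datasets. -/
theorem mle_version_space_validity {S A M : Type*}
    [Fintype S] [Nonempty S] [Fintype A] [Nonempty A] [Fintype M] [Nonempty M]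
    (μ : S × A → ℝ) (hμ0 : ∀ p, 0 ≤ μ p) (hμ1 : ∑ p : S × A, μ p = 1)
    (P : M → S → A → S → ℝ)
    (hP0 : ∀ m s a s', 0 < P m s a s')
    (hP1 : ∀ m s a, ∑ s' : S, P m s a s' = 1)
    (Mstar : M)
    (n : ℕ) (δ : ℝ) (hδ : δ ∈ Set.Ioc (0 : ℝ) 1) :
    ∑ d ∈ Finset.univ.filter (fun d : Fin n → (S × A) × S =>
        ∃ m : M,
          (∑ i : Fin n, Real.log (P m (d i).1.1 (d i).1.2 (d i).2)) -
            (∑ i : Fin n, Real.log (P Mstar (d i).1.1 (d i).1.2 (d i).2)) >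
          Real.log ((Fintype.card M : ℝ) / δ)),
      ∏ i : Fin n, μ (d i).1 * P Mstar (d i).1.1 (d i).1.2 (d i).2
    ≤ δ := by
  obtain ⟨hδ0, hδ1⟩ := hδ
  have hc : (0 : ℝ) < Fintype.card M := by exact_mod_cast Fintype.card_pos
  have hnn : ∀ (m : M) (d : Fin n → (S × A) × S),
      0 ≤ ∏ i : Fin n, μ (d i).1 * P m (d i).1.1 (d i).1.2 (d i).2 := fun m d =>
    Finset.prod_nonneg fun i _ => mul_nonneg (hμ0 _) (hP0 _ _ _ _).le
  have hone : ∀ m : M, ∑ d : Fin n → (S × A) × S,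
      ∏ i : Fin n, μ (d i).1 * P m (d i).1.1 (d i).1.2 (d i).2 = 1 := by
    intro m
    rw [← Fintype.sum_pow (fun x : (S × A) × S => μ x.1 * P m x.1.1 x.1.2 x.2) n]
    rw [Fintype.sum_prod_type]
    simp only [← Finset.mul_sum, hP1, mul_one, hμ1, one_pow]
  calc _ ≤ ∑ d ∈ Finset.univ.filter (fun d : Fin n → (S × A) × S =>
        ∃ m : M,
          (∑ i : Fin n, Real.log (P m (d i).1.1 (d i).1.2 (d i).2)) -
            (∑ i : Fin n, Real.log (P Mstar (d i).1.1 (d i).1.2 (d i).2)) >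
          Real.log ((Fintype.card M : ℝ) / δ)), δ / Fintype.card M * ∑ m : M,
          ∏ i : Fin n, μ (d i).1 * P m (d i).1.1 (d i).1.2 (d i).2 := by
        refine Finset.sum_le_sum fun d hd => ?_
        obtain ⟨m, hm⟩ := (Finset.mem_filter.1 hd).2
        rw [← Real.log_prod (fun i _ => (hP0 _ _ _ _).ne'),
          ← Real.log_prod (fun i _ => (hP0 _ _ _ _).ne')] at hm
        have h1 : 0 < ∏ i : Fin n, P m (d i).1.1 (d i).1.2 (d i).2 :=
          Finset.prod_pos fun i _ => hP0 _ _ _ _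
        have h2 : 0 < ∏ i : Fin n, P Mstar (d i).1.1 (d i).1.2 (d i).2 :=
          Finset.prod_pos fun i _ => hP0 _ _ _ _
        rw [← Real.log_div h1.ne' h2.ne', gt_iff_lt,
          Real.log_lt_log_iff (by positivity) (by positivity),
          div_lt_div_iff₀ hδ0 h2] at hm
        have h3 : 0 ≤ ∏ i : Fin n, μ (d i).1 := Finset.prod_nonneg fun i _ => hμ0 _
        refine le_trans ?_ (mul_le_mul_of_nonneg_left
          (Finset.single_le_sum (fun m _ => hnn m d) (Finset.mem_univ m)) (by positivity))
        rw [Finset.prod_mul_distrib, Finset.prod_mul_distrib, div_mul_eq_mul_div,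
          le_div_iff₀ hc]
        nlinarith [mul_le_mul_of_nonneg_left hm.le h3]
    _ ≤ ∑ d : Fin n → (S × A) × S, δ / Fintype.card M * ∑ m : M,
          ∏ i : Fin n, μ (d i).1 * P m (d i).1.1 (d i).1.2 (d i).2 := by
        refine Finset.sum_le_sum_of_subset_of_nonneg (Finset.filter_subset _ _) fun d _ _ => ?_
        exact mul_nonneg (by positivity) (Finset.sum_nonneg fun m _ => hnn m d)
    _ = δ := by
        rw [← Finset.mul_sum, Finset.sum_comm]
        simp only [hone, Finset.sum_const, Finset.card_univ, nsmul_eq_mul, mul_one]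
        field_simp
end
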